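/- Let β ∈ (0,1) and let λ ∈ ℂ with Re λ > 0. Then the function y ↦ e^{(1-β)y} (e^y + λ)^{-1} is Lebesgue integrable on ℝ and λ^{-β} = (sin(πβ)/π) ∫_{-∞}^{∞} e^{(1-β)y} (e^y + λ)^{-1} dy, where λ^{-β} denotes the principal power exp(-β · Log λ). -/

import Mathlib

open Real Complex MeasureTheory

theorem sigmoid_beta_integrand (β y : ℝ) :
    |Real.sigmoid y * (1 - Real.sigmoid y)| •
      ((Real.sigmoid y : ℂ) ^ ((1 - β : ℂ) - 1) * (1 - (Real.sigmoid y : ℂ)) ^ ((β : ℂ) - 1)) =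
    Complex.exp ((((1 - β) * y : ℝ) : ℂ)) * (Complex.exp ((y : ℝ) : ℂ) + 1)⁻¹ := by
  have h0 : 0 < Real.exp y + 1 := by positivity
  have hL : Real.exp (Real.log (Real.exp y + 1)) = Real.exp y + 1 := Real.exp_log h0
  set L := Real.log (Real.exp y + 1)
  have h1 : Real.sigmoid y = Real.exp (y - L) := by
    rw [Real.sigmoid_def, Real.exp_sub, hL, Real.exp_neg]
    field_simp
  have h2 : 1 - Real.sigmoid y = Real.exp (-L) := by
    rw [h1, Real.exp_neg, Real.exp_sub, hL]
    field_simp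
    ring
  have h2' : 1 - (Real.sigmoid y : ℂ) = ((Real.exp (-L) : ℝ) : ℂ) := by
    rw [← h2]; push_cast; rfl
  have e1 : (1 - β : ℂ) - 1 = ((-β : ℝ) : ℂ) := by push_cast; ring
  have e2 : (β : ℂ) - 1 = ((β - 1 : ℝ) : ℂ) := by push_cast; ring
  have e3 : Complex.exp ((y : ℝ) : ℂ) + 1 = ((Real.exp L : ℝ) : ℂ) := by
    rw [hL]; push_cast; rfl
  rw [h2', h2, h1, e1, e2, e3, ← Complex.ofReal_cpow (Real.exp_pos _).le,
    ← Complex.ofReal_cpow (Real.exp_pos _).le, ← Real.exp_mul, ← Real.exp_mul,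
    abs_of_pos (by positivity), Complex.real_smul, ← Complex.ofReal_exp, ← Complex.ofReal_inv,
    ← Real.exp_neg, ← Complex.ofReal_mul, ← Complex.ofReal_mul, ← Complex.ofReal_mul,
    ← Real.exp_add, ← Real.exp_add, ← Real.exp_add, ← Real.exp_add]
  congr 2
  ring

theorem integrable_exp_mul_inv_exp_add_one {β : ℝ} (hβ : β ∈ Set.Ioo 0 1) :
    Integrable (fun y : ℝ =>
      Complex.exp ((((1 - β) * y : ℝ) : ℂ)) * (Complex.exp ((y : ℝ) : ℂ) + 1)⁻¹) := by
  have h := Complex.betaIntegral_convergent (u := 1 - β) (v := β) (by simpa using hβ.2)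
    (by simpa using hβ.1)
  rw [intervalIntegrable_iff_integrableOn_Ioo_of_le zero_le_one, ← Real.range_sigmoid,
    ← Set.image_univ, integrableOn_image_iff_integrableOn_abs_deriv_smul MeasurableSet.univ
      (fun x _ => (Real.hasDerivAt_sigmoid x).hasDerivWithinAt) Real.sigmoid_injective.injOn,
    integrableOn_univ] at h
  exact h.congr (.of_forall fun y => sigmoid_beta_integrand β y)

theorem integral_exp_mul_inv_exp_add_one {β : ℝ} (hβ : β ∈ Set.Ioo 0 1) :
    ∫ y : ℝ, Complex.exp ((((1 - β) * y : ℝ) : ℂ)) * (Complex.exp ((y : ℝ) : ℂ) + 1)⁻¹ =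
      π / Complex.sin (π * β) := by
  have hu : 0 < (1 - β : ℂ).re := by simpa using hβ.2
  have hv : 0 < (β : ℂ).re := by simpa using hβ.1
  have h := Complex.betaIntegral_eq_Gamma_mul_div (1 - β) β hu hv
  rw [sub_add_cancel, Complex.Gamma_one, div_one, mul_comm, Complex.Gamma_mul_Gamma_one_sub,
    Complex.betaIntegral, intervalIntegral.integral_of_le zero_le_one,
    integral_Ioc_eq_integral_Ioo, ← Real.range_sigmoid, ← Set.image_univ,
    integral_image_eq_integral_abs_deriv_smul MeasurableSet.univ
      (fun x _ => (Real.hasDerivAt_sigmoid x).hasDerivWithinAt) Real.sigmoid_injective.injOn,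
    setIntegral_univ] at h
  rw [← h]
  exact integral_congr_ae (.of_forall fun y => (sigmoid_beta_integrand β y).symm)

theorem exp_add_re_le_norm (y : ℝ) (z : ℂ) :
    Real.exp y + z.re ≤ ‖Complex.exp ((y : ℝ) : ℂ) + z‖ := by
  refine le_trans (le_of_eq ?_) (Complex.re_le_norm _)
  simp [Complex.exp_ofReal_re]

theorem exp_add_ne_zero {z : ℂ} (hz : 0 < z.re) (y : ℝ) :
    Complex.exp ((y : ℝ) : ℂ) + z ≠ 0 :=
  norm_pos_iff.1 ((by positivity : 0 < Real.exp y + z.re).trans_le (exp_add_re_le_norm y z))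

theorem norm_inv_exp_add_le {r : ℝ} (hr : 0 < r) {z : ℂ} (hz : r ≤ z.re) (y : ℝ) :
    ‖(Complex.exp ((y : ℝ) : ℂ) + z)⁻¹‖ ≤ r⁻¹ := by
  rw [norm_inv]
  refine inv_anti₀ hr (le_trans ?_ (exp_add_re_le_norm y z))
  linarith [Real.exp_pos y]

theorem norm_inv_exp_add_le_mul {r : ℝ} (hr : 0 < r) {z : ℂ} (hz : r ≤ z.re) (y : ℝ) :
    ‖(Complex.exp ((y : ℝ) : ℂ) + z)⁻¹‖ ≤
      (min 1 r)⁻¹ * ‖(Complex.exp ((y : ℝ) : ℂ) + 1)⁻¹‖ := by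
  have hm : 0 < min 1 r := lt_min one_pos hr
  have h1 : ‖Complex.exp ((y : ℝ) : ℂ) + 1‖ = Real.exp y + 1 := by
    rw [← Complex.ofReal_exp, ← Complex.ofReal_one, ← Complex.ofReal_add, Complex.norm_real,
      Real.norm_of_nonneg (by positivity)]
  rw [norm_inv, norm_inv, ← mul_inv, h1]
  refine inv_anti₀ (by positivity) (le_trans ?_ (exp_add_re_le_norm y z))
  nlinarith [Real.exp_pos y, min_le_left 1 r, min_le_right 1 r]

theorem continuous_exp_mul_inv_exp_add (β : ℝ) {z : ℂ} (hz : 0 < z.re) :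
    Continuous (fun y : ℝ =>
      Complex.exp ((((1 - β) * y : ℝ) : ℂ)) * (Complex.exp ((y : ℝ) : ℂ) + z)⁻¹) :=
  Continuous.mul (by fun_prop) (Continuous.inv₀ (by fun_prop) (exp_add_ne_zero hz))

theorem integrable_exp_mul_inv_exp_add {β : ℝ} (hβ : β ∈ Set.Ioo 0 1) {z : ℂ} (hz : 0 < z.re) :
    Integrable (fun y : ℝ =>
      Complex.exp ((((1 - β) * y : ℝ) : ℂ)) * (Complex.exp ((y : ℝ) : ℂ) + z)⁻¹) := by
  refine ((integrable_exp_mul_inv_exp_add_one hβ).norm.const_mul (min 1 z.re)⁻¹).mono'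
    (continuous_exp_mul_inv_exp_add β hz).aestronglyMeasurable (.of_forall fun y => ?_)
  rw [norm_mul, norm_mul, mul_left_comm]
  gcongr
  exact norm_inv_exp_add_le_mul hz le_rfl y

theorem differentiableAt_integral_exp_mul_inv_exp_add {β : ℝ} (hβ : β ∈ Set.Ioo 0 1) {z : ℂ}
    (hz : 0 < z.re) :
    DifferentiableAt ℂ (fun w : ℂ => ∫ y : ℝ,
      Complex.exp ((((1 - β) * y : ℝ) : ℂ)) * (Complex.exp ((y : ℝ) : ℂ) + w)⁻¹) z := by
  have hr : 0 < z.re / 2 := by positivity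
  have hs : {w : ℂ | z.re / 2 < w.re} ∈ nhds z :=
    (isOpen_lt continuous_const Complex.continuous_re).mem_nhds (by simpa using hz)
  refine (hasDerivAt_integral_of_dominated_loc_of_deriv_le (μ := volume) hs
    (F := fun (w : ℂ) (y : ℝ) =>
      Complex.exp ((((1 - β) * y : ℝ) : ℂ)) * (Complex.exp ((y : ℝ) : ℂ) + w)⁻¹)
    (F' := fun (w : ℂ) (y : ℝ) => Complex.exp ((((1 - β) * y : ℝ) : ℂ)) *
      -((Complex.exp ((y : ℝ) : ℂ) + w)⁻¹ * (Complex.exp ((y : ℝ) : ℂ) + w)⁻¹))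
    (bound := fun y => ((min 1 (z.re / 2))⁻¹ * (z.re / 2)⁻¹) *
      ‖Complex.exp ((((1 - β) * y : ℝ) : ℂ)) * (Complex.exp ((y : ℝ) : ℂ) + 1)⁻¹‖)
    ?_ (integrable_exp_mul_inv_exp_add hβ hz) ?_ ?_ ?_ ?_).2.differentiableAt
  · filter_upwards [hs] with w hw
    exact (continuous_exp_mul_inv_exp_add β (hr.trans hw)).aestronglyMeasurable
  · have hc : Continuous fun y : ℝ => (Complex.exp ((y : ℝ) : ℂ) + z)⁻¹ :=
      Continuous.inv₀ (by fun_prop) (exp_add_ne_zero hz)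
    exact Continuous.aestronglyMeasurable (by fun_prop)
  · refine .of_forall fun y w hw => ?_
    rw [norm_mul, norm_neg, norm_mul, norm_mul]
    calc _ ≤ ‖Complex.exp ((((1 - β) * y : ℝ) : ℂ))‖ *
          (((min 1 (z.re / 2))⁻¹ * ‖(Complex.exp ((y : ℝ) : ℂ) + 1)⁻¹‖) * (z.re / 2)⁻¹) := by
          gcongr
          · exact norm_inv_exp_add_le_mul hr hw.le y
          · exact norm_inv_exp_add_le hr hw.le y
      _ = _ := by ring
  · exact (integrable_exp_mul_inv_exp_add_one hβ).norm.const_mul _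
  · refine .of_forall fun y w hw => ?_
    have hne := exp_add_ne_zero (hr.trans hw) y
    have h := (((hasDerivAt_id w).const_add (Complex.exp ((y : ℝ) : ℂ))).fun_inv hne).const_mul
      (Complex.exp ((((1 - β) * y : ℝ) : ℂ)))
    refine h.congr_deriv ?_
    simp only [id]
    field_simp

theorem integral_exp_mul_inv_exp_add_ofReal {β : ℝ} (hβ : β ∈ Set.Ioo 0 1) {a : ℝ} (ha : 0 < a) :
    ∫ y : ℝ, Complex.exp ((((1 - β) * y : ℝ) : ℂ)) * (Complex.exp ((y : ℝ) : ℂ) + a)⁻¹ =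
      π / Complex.sin (π * β) * (a : ℂ) ^ (-β : ℂ) := by
  have ha' : (a : ℂ) ≠ 0 := Complex.ofReal_ne_zero.2 ha.ne'
  rw [← integral_exp_mul_inv_exp_add_one hβ, ← integral_mul_const,
    ← integral_add_right_eq_self _ (Real.log a)]
  refine integral_congr_ae (.of_forall fun y => ?_)
  have hy : Complex.exp ((y : ℝ) : ℂ) + 1 ≠ 0 := exp_add_ne_zero (by simp) y
  have e1 : Complex.exp (((y + Real.log a : ℝ) : ℂ)) + a = a * (Complex.exp ((y : ℝ) : ℂ) + 1) := by
    rw [Complex.ofReal_add, Complex.exp_add, ← Complex.ofReal_exp (Real.log a), Real.exp_log ha]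
    ring
  have e2 : Complex.exp ((((1 - β) * (y + Real.log a) : ℝ) : ℂ)) =
      Complex.exp ((((1 - β) * y : ℝ) : ℂ)) * (a * (a : ℂ) ^ (-β : ℂ)) := by
    nth_rw 1 [← Complex.exp_log ha']
    rw [Complex.cpow_def_of_ne_zero ha', ← Complex.ofReal_log ha.le, ← Complex.exp_add,
      ← Complex.exp_add]
    congr 1
    push_cast
    ring
  simp only [e1, e2]
  field_simp

theorem integral_exp_mul_inv_exp_add {β : ℝ} (hβ : β ∈ Set.Ioo 0 1) {z : ℂ} (hz : 0 < z.re) :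
    ∫ y : ℝ, Complex.exp ((((1 - β) * y : ℝ) : ℂ)) * (Complex.exp ((y : ℝ) : ℂ) + z)⁻¹ =
      π / Complex.sin (π * β) * z ^ (-β : ℂ) := by
  have hU : IsOpen {w : ℂ | 0 < w.re} := isOpen_lt continuous_const Complex.continuous_re
  have hf : AnalyticOnNhd ℂ (fun w : ℂ => ∫ y : ℝ,
      Complex.exp ((((1 - β) * y : ℝ) : ℂ)) * (Complex.exp ((y : ℝ) : ℂ) + w)⁻¹)
      {w : ℂ | 0 < w.re} :=
    DifferentiableOn.analyticOnNhd (fun w hw =>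
      (differentiableAt_integral_exp_mul_inv_exp_add hβ hw).differentiableWithinAt) hU
  have hg : AnalyticOnNhd ℂ (fun w : ℂ => π / Complex.sin (π * β) * w ^ (-β : ℂ))
      {w : ℂ | 0 < w.re} :=
    DifferentiableOn.analyticOnNhd (fun w hw => ((differentiableAt_id.cpow_const
      (Or.inl hw)).const_mul _).differentiableWithinAt) hU
  refine hf.eqOn_of_preconnected_of_frequently_eq hg (convex_halfSpace_re_gt 0).isPreconnected
    (z₀ := ((1 : ℝ) : ℂ)) (by simp) ?_ hz
  have ht : Filter.Tendsto (fun x : ℝ => (x : ℂ)) (nhdsWithin 1 {1}ᶜ)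
      (nhdsWithin ((1 : ℝ) : ℂ) {((1 : ℝ) : ℂ)}ᶜ) :=
    Complex.continuous_ofReal.continuousWithinAt.tendsto_nhdsWithin fun x hx => by
      simpa using hx
  refine ht.frequently (Filter.Eventually.frequently ?_)
  filter_upwards [nhdsWithin_le_nhds (Ioi_mem_nhds one_pos)] with x hx
  exact integral_exp_mul_inv_exp_add_ofReal hβ hx

/-- Scalar Balakrishnan representation after the change of variable `μ = e^y`:
for `β ∈ (0,1)` and `Re λ > 0`, `y ↦ e^{(1-β)y} (e^y + λ)⁻¹` is integrable on `ℝ` and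
`λ^{-β} = (sin(πβ)/π) ∫_{-∞}^{∞} e^{(1-β)y} (e^y + λ)⁻¹ dy` (principal power). -/
theorem scalar_balakrishnan_exp
    (β : ℝ) (hβ : β ∈ Set.Ioo 0 1) (lam : ℂ) (hlam : 0 < lam.re) :
    Integrable (fun y : ℝ =>
      Complex.exp ((((1 - β) * y : ℝ) : ℂ)) * (Complex.exp ((y : ℝ) : ℂ) + lam)⁻¹) ∧
    lam ^ (-β : ℂ) =
      ((Real.sin (π * β) / π : ℝ) : ℂ) *
        ∫ y : ℝ, Complex.exp ((((1 - β) * y : ℝ) : ℂ)) * (Complex.exp ((y : ℝ) : ℂ) + lam)⁻¹ := by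
  refine ⟨integrable_exp_mul_inv_exp_add hβ hlam, ?_⟩
  have hsin : Complex.sin (π * β) ≠ 0 := by
    rw [← Complex.ofReal_mul, ← Complex.ofReal_sin]
    exact Complex.ofReal_ne_zero.2 (Real.sin_pos_of_pos_of_lt_pi (mul_pos Real.pi_pos hβ.1)
      (mul_lt_of_lt_one_right Real.pi_pos hβ.2)).ne'
  have hpi : (π : ℂ) ≠ 0 := Complex.ofReal_ne_zero.2 Real.pi_ne_zero
  rw [integral_exp_mul_inv_exp_add hβ hlam]
  push_cast
  rw [← mul_assoc, div_mul_div_cancel₀ hpi, div_self hsin, one_mul]
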